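/- arXiv:2107.09658 — 2 statements merged into one kernel-verified Lean document; each statement's English description precedes it below -/
import Mathlib

section
/- Let S ≤ S' be additive submonoids of ℕ with S ≠ S' and the pair (S, S') equi-gcd. If S is irreducible in S', then F(S'/S) has exactly one element. -/
/-- The pair `(S, S')` is equi-gcd: a natural number divides every element of `S`
iff it divides every element of `S'`. -/
def EquiGcd (S S' : AddSubmonoid ℕ) : Prop :=
  ∀ d : ℕ, (∀ x ∈ S, d ∣ x) ↔ (∀ x ∈ S', d ∣ x)

/-- The gap set `G(S'/S) = S' \ S`. -/
def gapSet (S S' : AddSubmonoid ℕ) : Set ℕ := (S' : Set ℕ) \ (S : Set ℕ)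

/-- The sporadic set `N(S'/S)` of elements of `S` not in the conductor. -/
def sporadicSet (S S' : AddSubmonoid ℕ) : Set ℕ :=
  {a : ℕ | a ∈ S ∧ ∃ t ∈ S', a + t ∉ S}

/-- The pseudo-Frobenius set `PF(S'/S)`. -/
def pseudoFrobSet (S S' : AddSubmonoid ℕ) : Set ℕ :=
  {w : ℕ | w ∈ S' ∧ w ∉ S ∧ ∀ s ∈ S, s ≠ 0 → w + s ∈ S}

/-- The Frobenius set `F(S'/S)`. -/
def frobSet (S S' : AddSubmonoid ℕ) : Set ℕ :=
  {w : ℕ | w ∈ S' ∧ w ∉ S ∧ ∀ t ∈ S', t ≠ 0 → w + t ∈ S}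

/-- `S` is irreducible in `S'`. -/
def IrreducibleIn (S S' : AddSubmonoid ℕ) : Prop :=
  ∀ T₁ T₂ : AddSubmonoid ℕ, S ≤ T₁ → T₁ ≤ S' → S ≤ T₂ → T₂ ≤ S' →
    T₁ ⊓ T₂ = S → T₁ = S ∨ T₂ = S

/-- The fundamental gap set `FG(S'/S)`. -/
def fundGapSet (S S' : AddSubmonoid ℕ) : Set ℕ :=
  {t : ℕ | t ∈ S' ∧ t ∉ S ∧ 2 * t ∈ S ∧ 3 * t ∈ S}

/-- Adjoining a Frobenius element `w` of `S'/S` to `S` yields a submonoid. -/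
def adjoinFrob (S S' : AddSubmonoid ℕ) (hSS' : S ≤ S') (w : ℕ) (hw : w ∈ frobSet S S') :
    AddSubmonoid ℕ where
  carrier := insert w S
  zero_mem' := Or.inr S.zero_mem
  add_mem' := by
    have key : ∀ b ∈ S', w + b ∈ insert w (S : Set ℕ) := fun b hb => by
      rcases eq_or_ne b 0 with rfl | hb0
      · exact Or.inl rfl
      · exact Or.inr (hw.2.2 b hb hb0)
    rintro a b (rfl | ha) (rfl | hb)
    · exact key _ hw.1
    · exact key _ (hSS' hb)
    · rw [add_comm]
      exact key _ (hSS' ha)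
    · exact Or.inr (S.add_mem ha hb)

theorem mem_adjoinFrob {S S' : AddSubmonoid ℕ} {hSS' : S ≤ S'} {w : ℕ} {hw : w ∈ frobSet S S'}
    {x : ℕ} : x ∈ adjoinFrob S S' hSS' w hw ↔ x = w ∨ x ∈ S :=
  Iff.rfl

theorem le_adjoinFrob {S S' : AddSubmonoid ℕ} (hSS' : S ≤ S') {w : ℕ} (hw : w ∈ frobSet S S') :
    S ≤ adjoinFrob S S' hSS' w hw :=
  fun _ => Or.inr

theorem adjoinFrob_le {S S' : AddSubmonoid ℕ} (hSS' : S ≤ S') {w : ℕ} (hw : w ∈ frobSet S S') :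
    adjoinFrob S S' hSS' w hw ≤ S' := by
  rintro x (rfl | hx)
  exacts [hw.1, hSS' hx]

theorem adjoinFrob_ne {S S' : AddSubmonoid ℕ} (hSS' : S ≤ S') {w : ℕ} (hw : w ∈ frobSet S S') :
    adjoinFrob S S' hSS' w hw ≠ S :=
  fun h => hw.2.1 (h.le (Or.inl rfl))

theorem finite_gapSet {S S' : AddSubmonoid ℕ} (hgcd : EquiGcd S S') : (gapSet S S').Finite := by
  obtain ⟨n, hn⟩ := Nat.exists_mem_closure_of_ge (S : Set ℕ)
  refine (Set.finite_lt_nat n).subset fun x hx => ?_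
  by_contra hlt
  have hdvd := (hgcd (Nat.setGcd (S : Set ℕ))).1 (fun y hy => Nat.setGcd_dvd_of_mem hy) x hx.1
  have := hn x (not_lt.1 hlt) hdvd
  rw [AddSubmonoid.closure_eq] at this
  exact hx.2 this

theorem frobSet_nonempty {S S' : AddSubmonoid ℕ} (hSS' : S ≤ S') (hne : S ≠ S')
    (hgcd : EquiGcd S S') : (frobSet S S').Nonempty := by
  have hgap : (gapSet S S').Nonempty := 
    Set.nonempty_of_ssubset (SetLike.coe_ssubset_coe.2 (lt_of_le_of_ne hSS' hne))
  obtain ⟨w, hw, hmax⟩ := Set.exists_max_image _ id (finite_gapSet hgcd) hgap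
  refine ⟨w, hw.1, hw.2, fun t ht ht0 => ?_⟩
  by_contra h
  have : w + t ≤ w := hmax (w + t) ⟨S'.add_mem hw.1 ht, h⟩
  lia

theorem frobSet_subsingleton {S S' : AddSubmonoid ℕ} (hSS' : S ≤ S')
    (hirr : IrreducibleIn S S') : (frobSet S S').Subsingleton := by
  intro v hv w hw
  by_contra hvw
  have hinf : adjoinFrob S S' hSS' v hv ⊓ adjoinFrob S S' hSS' w hw = S := by
    ext x
    rw [AddSubmonoid.mem_inf, mem_adjoinFrob, mem_adjoinFrob]
    grind
  rcases hirr _ _ (le_adjoinFrob hSS' hv) (adjoinFrob_le hSS' hv) (le_adjoinFrob hSS' hw)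
    (adjoinFrob_le hSS' hw) hinf with h | h
  exacts [adjoinFrob_ne hSS' hv h, adjoinFrob_ne hSS' hw h]

theorem irreducible_single_frob (S S' : AddSubmonoid ℕ) (hSS' : S ≤ S') (hne : S ≠ S')
    (hgcd : EquiGcd S S') (hirr : IrreducibleIn S S') :
    ∃! w : ℕ, w ∈ frobSet S S' := by
  obtain ⟨w, hw⟩ := frobSet_nonempty hSS' hne hgcd
  exact ⟨w, hw, fun _ hv => frobSet_subsingleton hSS' hirr hv hw⟩
end

section
/- Let S ≤ S' be additive submonoids of ℕ with S ≠ S' and the pair (S, S') equi-gcd. Then FG(S'/S) is a singleton if and only if every additive submonoid T with S ≤ T ≤ S' is an intersection of radicals of S in S', i.e. there exists a set A ⊆ ℕ with (T : Set ℕ) = {t ∈ ℕ : t ∈ S' ∧ ∀ n ∈ A, n * t ∈ S}. -/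
/-- Every element of `S'` has all its sufficiently large multiples in `S`. -/
theorem EquiGcd.exists_forall_ge_mul_mem {S S' : AddSubmonoid ℕ} (h : EquiGcd S S') {x : ℕ}
    (hx : x ∈ S') : ∃ n, ∀ m ≥ n, m * x ∈ S := by
  have hdvd : Nat.setGcd (S : Set ℕ) ∣ x :=
    (h _).1 (fun _ hy ↦ Nat.setGcd_dvd_of_mem hy) x hx
  obtain ⟨n, hn⟩ := Nat.exists_mem_closure_of_ge (S : Set ℕ)
  rw [AddSubmonoid.closure_eq] at hn
  rcases Nat.eq_zero_or_pos x with rfl | hpos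
  · exact ⟨0, fun m _ ↦ by simp⟩
  · exact ⟨n, fun m hm ↦ hn _ (hm.trans (Nat.le_mul_of_pos_right m hpos)) (hdvd.mul_left m)⟩

/-- Every gap has a multiple that is a fundamental gap. -/
theorem EquiGcd.exists_mul_mem_fundGapSet {S S' : AddSubmonoid ℕ} (h : EquiGcd S S') {x : ℕ}
    (hx : x ∈ S') (hxS : x ∉ S) : ∃ k, k * x ∈ fundGapSet S S' := by
  classical
  have hex := h.exists_forall_ge_mul_mem hx
  have hspec := Nat.find_spec hex
  have hlt : 1 < Nat.find hex := by
    by_contra! hle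
    exact hxS (by simpa using hspec 1 hle)
  obtain ⟨k, hk⟩ : ∃ k, Nat.find hex = k + 1 := ⟨Nat.find hex - 1, by omega⟩
  refine ⟨k, by simpa using S'.nsmul_mem hx k, fun hkS ↦ ?_, ?_, ?_⟩
  · refine Nat.find_min hex (m := k) (by omega) fun m hm ↦ ?_
    rcases hm.eq_or_lt with rfl | hm
    · exact hkS
    · exact hspec m (by omega)
  · rw [← mul_assoc]
    exact hspec _ (by omega)
  · rw [← mul_assoc]
    exact hspec _ (by omega)

/-- Proper multiples of a fundamental gap belong to `S`. -/
theorem mul_mem_of_mem_fundGapSet {S S' : AddSubmonoid ℕ} {t m : ℕ} (ht : t ∈ fundGapSet S S')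
    (hm : m ≠ 1) : m * t ∈ S := by
  obtain ⟨a, b, rfl⟩ : ∃ a b, m = a * 2 + b * 3 := by
    obtain ⟨k, rfl | rfl⟩ := m.even_or_odd'
    · exact ⟨k, 0, by omega⟩
    · exact ⟨k - 1, 1, by omega⟩
  rw [add_mul, mul_assoc, mul_assoc]
  exact S.add_mem (by simpa using S.nsmul_mem ht.2.2.1 a) (by simpa using S.nsmul_mem ht.2.2.2 b)

/-- The additive submonoid `S ∪ (S + t)`, for `t` with `2 * t ∈ S`. -/
def adjoin (S : AddSubmonoid ℕ) (t : ℕ) (ht : 2 * t ∈ S) : AddSubmonoid ℕ where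
  carrier := {x | x ∈ S ∨ ∃ s ∈ S, x = s + t}
  zero_mem' := Or.inl S.zero_mem
  add_mem' := by
    rintro x y (hx | ⟨s, hs, rfl⟩) (hy | ⟨u, hu, rfl⟩)
    · exact Or.inl (S.add_mem hx hy)
    · exact Or.inr ⟨x + u, S.add_mem hx hu, by ring⟩
    · exact Or.inr ⟨s + y, S.add_mem hs hy, by ring⟩
    · refine Or.inl ?_
      have hsum : s + t + (u + t) = s + u + 2 * t := by ring
      rw [hsum]
      exact S.add_mem (S.add_mem hs hu) ht

/-- If every intermediate submonoid is an intersection of radicals, then no fundamental gap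
exceeds another. -/
theorem le_of_mem_fundGapSet {S S' : AddSubmonoid ℕ} (hSS' : S ≤ S')
    (hrad : ∀ T : AddSubmonoid ℕ, S ≤ T → T ≤ S' →
      ∃ A : Set ℕ, (T : Set ℕ) = {t : ℕ | t ∈ S' ∧ ∀ m ∈ A, m * t ∈ S})
    {t u : ℕ} (ht : t ∈ fundGapSet S S') (hu : u ∈ fundGapSet S S') : t ≤ u := by
  obtain ⟨A, hA⟩ := hrad (adjoin S t ht.2.2.1) (fun _ ↦ Or.inl) (by
    rintro x (hx | ⟨s, hs, rfl⟩)
    exacts [hSS' hx, S'.add_mem (hSS' hs) ht.1])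
  have htA : t ∈ {x : ℕ | x ∈ S' ∧ ∀ m ∈ A, m * x ∈ S} :=
    hA ▸ (Or.inr ⟨0, S.zero_mem, by simp⟩ : t ∈ S ∨ ∃ s ∈ S, t = s + t)
  have huT : u ∈ ((adjoin S t ht.2.2.1 : AddSubmonoid ℕ) : Set ℕ) := by
    rw [hA]
    refine ⟨hu.1, fun m hm ↦ mul_mem_of_mem_fundGapSet hu ?_⟩
    rintro rfl
    exact ht.2.1 (by simpa using htA.2 1 hm)
  rcases huT with huS | ⟨s, -, rfl⟩
  · exact absurd huS hu.2.1
  · exact Nat.le_add_left t s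

theorem single_fund_gap_iff_all_ext_radical (S S' : AddSubmonoid ℕ) (hSS' : S ≤ S')
    (hne : S ≠ S') (hgcd : EquiGcd S S') :
    (∃ t : ℕ, fundGapSet S S' = {t}) ↔
      ∀ T : AddSubmonoid ℕ, S ≤ T → T ≤ S' →
        ∃ A : Set ℕ, (T : Set ℕ) = {t : ℕ | t ∈ S' ∧ ∀ m ∈ A, m * t ∈ S} := by
  constructor
  · rintro ⟨f, hf⟩ T hST hTS'
    have hmul {x : ℕ} (hx : x ∈ S') (hxS : x ∉ S) : ∃ k, k * x = f := by
      simpa [hf] using hgcd.exists_mul_mem_fundGapSet hx hxS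
    have hfS : f ∉ S := (hf.symm ▸ Set.mem_singleton f : f ∈ fundGapSet S S').2.1
    refine ⟨{m | ∀ t ∈ T, m * t ∈ S}, Set.Subset.antisymm
      (fun t ht ↦ ⟨hTS' ht, fun m hm ↦ hm t ht⟩) ?_⟩
    rintro x ⟨hx, hxA⟩
    by_contra hxT
    obtain ⟨k, hk⟩ := hmul hx fun hxS ↦ hxT (hST hxS)
    refine hfS (hk ▸ hxA k fun t ht ↦ ?_)
    by_contra hkt
    obtain ⟨j, hj⟩ := hmul (by simpa using S'.nsmul_mem (hTS' ht) k) hkt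
    have hk0 : k ≠ 0 := by
      rintro rfl
      exact hkt (by simp)
    have hxj : x = j * t := by
      apply mul_left_cancel₀ hk0
      rw [hk, ← hj]
      ring
    exact hxT (hxj ▸ by simpa using T.nsmul_mem ht j)
  · intro hrad
    obtain ⟨x, hx, hxS⟩ := SetLike.exists_of_lt (lt_of_le_of_ne hSS' hne)
    obtain ⟨k, hk⟩ := hgcd.exists_mul_mem_fundGapSet hx hxS
    exact ⟨k * x, Set.eq_singleton_iff_unique_mem.2 ⟨hk, fun t ht ↦
      (le_of_mem_fundGapSet hSS' hrad ht hk).antisymm (le_of_mem_fundGapSet hSS' hrad hk ht)⟩⟩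
end
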